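/- Let ∇ be the torsion-free affine connection on ℝ³ with nonzero Christoffel symbols ∇_{∂₁}∂₁ = f₁∂₁, ∇_{∂₁}∂₂ = f₂∂₁, ∇_{∂₁}∂₃ = f₃∂₁. Then (ℝ³,∇) is affine Szabó (every affine Szabó operator S(X) is nilpotent, with characteristic polynomial λ³) if and only if the Ricci tensor of ∇ is cyclic parallel. -/

import Mathlib

open scoped BigOperators

noncomputable section AffineSzabo

variable {ι : Type} [Fintype ι] [DecidableEq ι]

/-- Points of the coordinate chart. -/
abbrev Pt (ι : Type) := ι → ℝ
/-- Vector fields in coordinates. -/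
abbrev VF (ι : Type) := Pt ι → Pt ι
/-- Christoffel symbols `Γ p i j k = Γ^i_{jk}(p)` of a torsion-free affine connection. -/
abbrev Chr (ι : Type) := Pt ι → ι → ι → ι → ℝ

/-- Partial derivative in the `j`-th coordinate direction. -/
def pd (j : ι) (f : Pt ι → ℝ) (p : Pt ι) : ℝ :=
  fderiv ℝ f p (Pi.single j 1)

/-- The covariant derivative `∇_X Y` of the affine connection with Christoffel symbols `Γ`. -/
def conn (Γ : Chr ι) (X Y : VF ι) : VF ι :=
  fun p i => fderiv ℝ (fun q => Y q i) p (X p) + ∑ j, ∑ k, Γ p i j k * X p j * Y p k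

/-- The Lie bracket of vector fields. -/
def bracket (X Y : VF ι) : VF ι :=
  fun p i => fderiv ℝ (fun q => Y q i) p (X p) - fderiv ℝ (fun q => X q i) p (Y p)

/-- The curvature tensor `R(X,Y)Z = ∇_X∇_Y Z − ∇_Y∇_X Z − ∇_{[X,Y]}Z`. -/
def curv (Γ : Chr ι) (X Y Z : VF ι) : VF ι :=
  conn Γ X (conn Γ Y Z) - conn Γ Y (conn Γ X Z) - conn Γ (bracket X Y) Z

/-- The covariant derivative of the curvature tensor,
`(∇_X R)(Y,Z)W = ∇_X(R(Y,Z)W) − R(∇_X Y,Z)W − R(Y,∇_X Z)W − R(Y,Z)∇_X W`. -/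
def covCurv (Γ : Chr ι) (X Y Z W : VF ι) : VF ι :=
  conn Γ X (curv Γ Y Z W) - curv Γ (conn Γ X Y) Z W - curv Γ Y (conn Γ X Z) W
    - curv Γ Y Z (conn Γ X W)

/-- The affine Szabó operator `S(X)Y = (∇_X R)(Y,X)X`. -/
def szabo (Γ : Chr ι) (X Y : VF ι) : VF ι := covCurv Γ X Y X X

/-- The constant vector field extending a tangent vector `v`. -/
def cvf (v : Pt ι) : VF ι := fun _ => v

/-- The matrix of the affine Szabó operator `S(X)` at the point `p` with respect to the
tangent vector `X = v`, in the coordinate basis. -/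
def szaboMat (Γ : Chr ι) (p v : Pt ι) : Matrix ι ι ℝ :=
  Matrix.of fun i m => szabo Γ (cvf v) (cvf (Pi.single m 1)) p i

/-- The Ricci tensor `Ric(X,Y) = trace (Z ↦ R(Z,X)Y)`. -/
def ricci (Γ : Chr ι) (X Y : VF ι) (p : Pt ι) : ℝ :=
  ∑ i, curv Γ (cvf (Pi.single i 1)) X Y p i

/-- The covariant derivative of the Ricci tensor,
`(∇_X Ric)(Z,W) = X(Ric(Z,W)) − Ric(∇_X Z,W) − Ric(Z,∇_X W)`. -/
def covRic (Γ : Chr ι) (X Z W : VF ι) (p : Pt ι) : ℝ :=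
  fderiv ℝ (ricci Γ Z W) p (X p) - ricci Γ (conn Γ X Z) W p - ricci Γ Z (conn Γ X W) p

/-- A vector field is smooth if its components are smooth. -/
def SmoothVF (X : VF ι) : Prop := ∀ i, ContDiff ℝ (⊤ : ℕ∞) fun p => X p i

/-- A connection is smooth if its Christoffel symbols are smooth. -/
def SmoothChr (Γ : Chr ι) : Prop := ∀ i j k, ContDiff ℝ (⊤ : ℕ∞) fun p => Γ p i j k

/-- The Ricci tensor of `Γ` is cyclic parallel: `(∇_X Ric)(X,X) = 0` for all vector fields `X`. -/
def CyclicParallelRic (Γ : Chr ι) : Prop :=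
  ∀ X : VF ι, SmoothVF X → ∀ p, covRic Γ X X X p = 0

/-- The connection is affine Szabó: every affine Szabó operator is nilpotent. -/
def AffineSzabo (Γ : Chr ι) : Prop :=
  ∀ p v : Pt ι, IsNilpotent (szaboMat Γ p v)


/-- The connection of Case 1: `∇_{∂₁}∂₁ = f₁∂₁`, `∇_{∂₁}∂₂ = ∇_{∂₂}∂₁ = f₂∂₁`,
`∇_{∂₁}∂₃ = ∇_{∂₃}∂₁ = f₃∂₁`, all other Christoffel symbols zero. -/
def gammaA (f1 f2 f3 : Pt (Fin 3) → ℝ) : Chr (Fin 3) := fun p i j k =>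
  if i = 0 then
    if j = 0 ∧ k = 0 then f1 p
    else if (j = 0 ∧ k = 1) ∨ (j = 1 ∧ k = 0) then f2 p
    else if (j = 0 ∧ k = 2) ∨ (j = 2 ∧ k = 0) then f3 p
    else 0
  else 0

section VectorFields

variable {κ : Type} [Fintype κ]

/-- The quadratic part `Γ(x, y)` of the covariant derivative at `p`. -/
def chrApply (Γ : Chr κ) (p x y : Pt κ) : Pt κ :=
  fun i => ∑ j, ∑ k, Γ p i j k * x j * y k

lemma conn_apply (Γ : Chr κ) (X Y : VF κ) (p : Pt κ) (i : κ) :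
    conn Γ X Y p i = fderiv ℝ (fun q => Y q i) p (X p) + chrApply Γ p (X p) (Y p) i := rfl

lemma smoothVF_cvf (v : Pt κ) : SmoothVF (cvf v) := fun _ => contDiff_const

lemma SmoothVF.contDiff {X : VF κ} (hX : SmoothVF X) : ContDiff ℝ (⊤ : ℕ∞) X :=
  contDiff_pi.2 hX

lemma contDiff_fderiv_apply {f : Pt κ → ℝ} (hf : ContDiff ℝ (⊤ : ℕ∞) f) {X : VF κ}
    (hX : SmoothVF X) : ContDiff ℝ (⊤ : ℕ∞) fun p => fderiv ℝ f p (X p) :=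
  (hf.fderiv_right le_rfl).clm_apply hX.contDiff

lemma contDiff_chrApply {Γ : Chr κ} (hΓ : SmoothChr Γ) {X Y : VF κ} (hX : SmoothVF X)
    (hY : SmoothVF Y) (i : κ) :
    ContDiff ℝ (⊤ : ℕ∞) fun p => chrApply Γ p (X p) (Y p) i :=
  ContDiff.sum fun j _ => ContDiff.sum fun k _ => ((hΓ i j k).mul (hX j)).mul (hY k)

lemma SmoothVF.conn {Γ : Chr κ} (hΓ : SmoothChr Γ) {X Y : VF κ} (hX : SmoothVF X)
    (hY : SmoothVF Y) : SmoothVF (conn Γ X Y) := fun i =>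
  (contDiff_fderiv_apply (hY i) hX).add (contDiff_chrApply hΓ hX hY i)

/-- Leibniz rule for the contraction of a 2-tensor with two vector fields. -/
lemma fderiv_bilin {a : Pt κ → κ → κ → ℝ} {Y Z : VF κ} {p : Pt κ}
    (ha : ∀ j k, DifferentiableAt ℝ (fun q => a q j k) p)
    (hY : ∀ j, DifferentiableAt ℝ (fun q => Y q j) p)
    (hZ : ∀ k, DifferentiableAt ℝ (fun q => Z q k) p) (x : Pt κ) :
    fderiv ℝ (fun q => ∑ j, ∑ k, a q j k * Y q j * Z q k) p x =
      (∑ j, ∑ k, fderiv ℝ (fun q => a q j k) p x * Y p j * Z p k)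
        + (∑ j, ∑ k, a p j k * fderiv ℝ (fun q => Y q j) p x * Z p k)
        + ∑ j, ∑ k, a p j k * Y p j * fderiv ℝ (fun q => Z q k) p x := by
  have h : HasFDerivAt (fun q => ∑ j, ∑ k, a q j k * Y q j * Z q k) _ p :=
    HasFDerivAt.fun_sum fun j _ => HasFDerivAt.fun_sum fun k _ =>
      (((ha j k).hasFDerivAt.mul (hY j).hasFDerivAt).mul (hZ k).hasFDerivAt)
  rw [h.fderiv]
  simp only [sum_apply, add_apply,
    smul_apply, smul_eq_mul, ← Finset.sum_add_distrib, Pi.mul_apply]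
  exact Finset.sum_congr rfl fun j _ => Finset.sum_congr rfl fun k _ => by ring

lemma chrApply_add_right (Γ : Chr κ) (p x y z : Pt κ) (i : κ) :
    chrApply Γ p x (y + z) i = chrApply Γ p x y i + chrApply Γ p x z i := by
  simp only [chrApply, Pi.add_apply, mul_add, Finset.sum_add_distrib]

lemma chrApply_sub_left (Γ : Chr κ) (p x y z : Pt κ) (i : κ) :
    chrApply Γ p (x - y) z i = chrApply Γ p x z i - chrApply Γ p y z i := by
  simp only [chrApply, Pi.sub_apply, mul_sub, sub_mul, Finset.sum_sub_distrib]

lemma chrApply_chrApply (Γ : Chr κ) (p x y z : Pt κ) (i : κ) :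
    chrApply Γ p x (chrApply Γ p y z) i =
      ∑ j, ∑ k, ∑ l, (∑ m, Γ p i j m * Γ p m k l) * x j * y k * z l := by
  simp only [chrApply, Finset.sum_mul, Finset.mul_sum]
  refine Finset.sum_congr rfl fun j _ => ?_
  rw [Finset.sum_comm]
  refine Finset.sum_congr rfl fun k _ => ?_
  rw [Finset.sum_comm]
  exact Finset.sum_congr rfl fun l _ => Finset.sum_congr rfl fun m _ => by ring

lemma conn_conn_apply {Γ : Chr κ} (hΓ : SmoothChr Γ) (X : VF κ) {Y Z : VF κ}
    (hY : SmoothVF Y) (hZ : SmoothVF Z) (p : Pt κ) (i : κ) :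
    conn Γ X (conn Γ Y Z) p i =
      fderiv ℝ (fderiv ℝ fun q => Z q i) p (X p) (Y p)
      + fderiv ℝ (fun q => Z q i) p (fun m => fderiv ℝ (fun q => Y q m) p (X p))
      + (∑ j, ∑ k, fderiv ℝ (fun q => Γ q i j k) p (X p) * Y p j * Z p k)
      + chrApply Γ p (fun m => fderiv ℝ (fun q => Y q m) p (X p)) (Z p) i
      + chrApply Γ p (Y p) (fun m => fderiv ℝ (fun q => Z q m) p (X p)) i
      + chrApply Γ p (X p) (fun m => fderiv ℝ (fun q => Z q m) p (Y p)) i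
      + chrApply Γ p (X p) (chrApply Γ p (Y p) (Z p)) i := by
  have diff {f : Pt κ → ℝ} (hf : ContDiff ℝ (⊤ : ℕ∞) f) : DifferentiableAt ℝ f p :=
    hf.differentiable (by simp) p
  have hY' : HasFDerivAt Y (ContinuousLinearMap.pi fun m => fderiv ℝ (fun q => Y q m) p) p :=
    hasFDerivAt_pi.2 fun m => (diff (hY m)).hasFDerivAt
  have hDZ : DifferentiableAt ℝ (fderiv ℝ fun q => Z q i) p :=
    (((hZ i).fderiv_right (m := (⊤ : ℕ∞)) le_rfl).differentiable (by simp)) p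
  have hfirst : fderiv ℝ (fun q => fderiv ℝ (fun q => Z q i) q (Y q)) p (X p) =
      fderiv ℝ (fderiv ℝ fun q => Z q i) p (X p) (Y p)
      + fderiv ℝ (fun q => Z q i) p (fun m => fderiv ℝ (fun q => Y q m) p (X p)) := by
    rw [(hDZ.hasFDerivAt.clm_apply hY').fderiv]
    simp only [add_apply, ContinuousLinearMap.comp_apply,
      ContinuousLinearMap.flip_apply]
    rw [add_comm]
    rfl
  have hsecond := fderiv_bilin (a := fun q j k => Γ q i j k) (fun j k => diff (hΓ i j k))
    (fun j => diff (hY j)) (fun k => diff (hZ k)) (X p)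
  have hsum : fderiv ℝ (fun q => conn Γ Y Z q i) p (X p) =
      fderiv ℝ (fun q => fderiv ℝ (fun q => Z q i) q (Y q)) p (X p)
      + fderiv ℝ (fun q => ∑ j, ∑ k, Γ q i j k * Y q j * Z q k) p (X p) := by
    have := fderiv_fun_add (diff (contDiff_fderiv_apply (hZ i) hY))
      (diff (contDiff_chrApply hΓ hY hZ i))
    exact congrArg (fun L => L (X p)) this
  have hlast : chrApply Γ p (X p) (conn Γ Y Z p) i =
      chrApply Γ p (X p) (fun m => fderiv ℝ (fun q => Z q m) p (Y p)) i
      + chrApply Γ p (X p) (chrApply Γ p (Y p) (Z p)) i := chrApply_add_right ..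
  rw [conn_apply, hsum, hfirst, hsecond, hlast]
  simp only [chrApply]
  ring

end VectorFields

/-- The components `R^i_{jkl}` of the curvature tensor, `R(∂_j,∂_k)∂_l = R^i_{jkl} ∂_i`. -/
def curvCoeff (Γ : Chr ι) (p : Pt ι) (i j k l : ι) : ℝ :=
  pd j (fun q => Γ q i k l) p - pd k (fun q => Γ q i j l) p
    + (∑ m, Γ p i j m * Γ p m k l - ∑ m, Γ p i k m * Γ p m j l)

/-- The components of the Ricci tensor. -/
def ricciCoeff (Γ : Chr ι) (p : Pt ι) (k l : ι) : ℝ := ∑ i, curvCoeff Γ p i i k l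

/-- The covariant derivative of the Ricci tensor as a function of tangent vectors at `p`. -/
def covRicAt (Γ : Chr ι) (p x z w : Pt ι) : ℝ :=
  (∑ k, ∑ l, fderiv ℝ (fun q => ricciCoeff Γ q k l) p x * z k * w l)
    - (∑ k, ∑ l, ricciCoeff Γ p k l * chrApply Γ p x z k * w l)
    - ∑ k, ∑ l, ricciCoeff Γ p k l * z k * chrApply Γ p x w l

lemma fderiv_eq_sum_pd (f : Pt ι → ℝ) (p x : Pt ι) :
    fderiv ℝ f p x = ∑ j, pd j f p * x j := by
  conv_lhs => rw [← Finset.univ_sum_single x]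
  rw [map_sum]
  refine Finset.sum_congr rfl fun j _ => ?_
  have : Pi.single j (x j) = x j • (Pi.single j 1 : Pt ι) := by
    rw [← Pi.single_smul, smul_eq_mul, mul_one]
  rw [this, map_smul, smul_eq_mul, mul_comm, pd]

lemma contDiff_curvCoeff {Γ : Chr ι} (hΓ : SmoothChr Γ) (i j k l : ι) :
    ContDiff ℝ (⊤ : ℕ∞) fun p => curvCoeff Γ p i j k l := by
  refine ContDiff.add (ContDiff.sub ?_ ?_) (ContDiff.sub ?_ ?_)
  · exact contDiff_fderiv_apply (hΓ i k l) (smoothVF_cvf (Pi.single j 1))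
  · exact contDiff_fderiv_apply (hΓ i j l) (smoothVF_cvf (Pi.single k 1))
  · exact ContDiff.sum fun m _ => (hΓ i j m).mul (hΓ m k l)
  · exact ContDiff.sum fun m _ => (hΓ i k m).mul (hΓ m j l)

lemma contDiff_ricciCoeff {Γ : Chr ι} (hΓ : SmoothChr Γ) (k l : ι) :
    ContDiff ℝ (⊤ : ℕ∞) fun p => ricciCoeff Γ p k l :=
  ContDiff.sum fun i _ => contDiff_curvCoeff hΓ i i k l

/-- The curvature of vector fields is tensorial. -/
lemma curv_apply {Γ : Chr ι} (hΓ : SmoothChr Γ) {X Y Z : VF ι} (hX : SmoothVF X)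
    (hY : SmoothVF Y) (hZ : SmoothVF Z) (p : Pt ι) (i : ι) :
    curv Γ X Y Z p i = ∑ j, ∑ k, ∑ l, curvCoeff Γ p i j k l * X p j * Y p k * Z p l := by
  have hbr : conn Γ (bracket X Y) Z p i =
      fderiv ℝ (fun q => Z q i) p (fun m => fderiv ℝ (fun q => Y q m) p (X p))
      - fderiv ℝ (fun q => Z q i) p (fun m => fderiv ℝ (fun q => X q m) p (Y p))
      + (chrApply Γ p (fun m => fderiv ℝ (fun q => Y q m) p (X p)) (Z p) i
      - chrApply Γ p (fun m => fderiv ℝ (fun q => X q m) p (Y p)) (Z p) i) := by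
    rw [← map_sub, ← chrApply_sub_left]
    rfl
  have hsymm : fderiv ℝ (fderiv ℝ fun q => Z q i) p (X p) (Y p) =
      fderiv ℝ (fderiv ℝ fun q => Z q i) p (Y p) (X p) :=
    ((hZ i).contDiffAt.isSymmSndFDerivAt
      (by simpa using WithTop.coe_le_coe.2 (le_top : (2 : ℕ∞) ≤ ⊤))).eq _ _
  have hX' : ∑ j, ∑ k, fderiv ℝ (fun q => Γ q i j k) p (X p) * Y p j * Z p k =
      ∑ j, ∑ k, ∑ l, pd j (fun q => Γ q i k l) p * X p j * Y p k * Z p l := by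
    simp only [fderiv_eq_sum_pd, Finset.sum_mul]
    exact (Finset.sum_congr rfl fun k _ => Finset.sum_comm).trans Finset.sum_comm
  have hY' : ∑ j, ∑ k, fderiv ℝ (fun q => Γ q i j k) p (Y p) * X p j * Z p k =
      ∑ j, ∑ k, ∑ l, pd k (fun q => Γ q i j l) p * X p j * Y p k * Z p l := by
    simp only [fderiv_eq_sum_pd, Finset.sum_mul]
    refine Finset.sum_congr rfl fun j _ => ?_
    rw [Finset.sum_comm]
    exact Finset.sum_congr rfl fun k _ => Finset.sum_congr rfl fun l _ => by ring
  have hYX : chrApply Γ p (Y p) (chrApply Γ p (X p) (Z p)) i =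
      ∑ j, ∑ k, ∑ l, (∑ m, Γ p i k m * Γ p m j l) * X p j * Y p k * Z p l := by
    rw [chrApply_chrApply, Finset.sum_comm]
    exact Finset.sum_congr rfl fun j _ => Finset.sum_congr rfl fun k _ =>
      Finset.sum_congr rfl fun l _ => by ring
  have hcoeff : ∑ j, ∑ k, ∑ l, curvCoeff Γ p i j k l * X p j * Y p k * Z p l =
      (∑ j, ∑ k, ∑ l, pd j (fun q => Γ q i k l) p * X p j * Y p k * Z p l)
      - (∑ j, ∑ k, ∑ l, pd k (fun q => Γ q i j l) p * X p j * Y p k * Z p l)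
      + ((∑ j, ∑ k, ∑ l, (∑ m, Γ p i j m * Γ p m k l) * X p j * Y p k * Z p l)
      - ∑ j, ∑ k, ∑ l, (∑ m, Γ p i k m * Γ p m j l) * X p j * Y p k * Z p l) := by
    simp only [curvCoeff, ← Finset.sum_add_distrib, ← Finset.sum_sub_distrib, ← add_mul, ← sub_mul]
  rw [hcoeff, ← hX', ← hY', ← hYX, ← chrApply_chrApply]
  change conn Γ X (conn Γ Y Z) p i - conn Γ Y (conn Γ X Z) p i - conn Γ (bracket X Y) Z p i = _
  rw [conn_conn_apply hΓ X hY hZ, conn_conn_apply hΓ Y hX hZ, hbr, hsymm]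
  ring

lemma ricci_apply {Γ : Chr ι} (hΓ : SmoothChr Γ) {X Y : VF ι} (hX : SmoothVF X)
    (hY : SmoothVF Y) (p : Pt ι) :
    ricci Γ X Y p = ∑ k, ∑ l, ricciCoeff Γ p k l * X p k * Y p l := by
  simp only [ricci, curv_apply hΓ (smoothVF_cvf _) hX hY, ricciCoeff, Finset.sum_mul]
  have (i : ι) : ∑ j, ∑ k, ∑ l, curvCoeff Γ p i j k l * cvf (Pi.single i 1) p j * X p k * Y p l =
      ∑ k, ∑ l, curvCoeff Γ p i i k l * X p k * Y p l := by
    rw [Finset.sum_eq_single i]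
    · simp [cvf]
    · intro j _ hj
      simp [cvf, hj]
    · simp
  simp only [this]
  rw [Finset.sum_comm]
  refine Finset.sum_congr rfl fun k _ => ?_
  rw [Finset.sum_comm]

/-- The covariant derivative of the Ricci tensor is tensorial. -/
lemma covRic_apply {Γ : Chr ι} (hΓ : SmoothChr Γ) {X Z W : VF ι} (hX : SmoothVF X)
    (hZ : SmoothVF Z) (hW : SmoothVF W) (p : Pt ι) :
    covRic Γ X Z W p = covRicAt Γ p (X p) (Z p) (W p) := by
  have diff {f : Pt ι → ℝ} (hf : ContDiff ℝ (⊤ : ℕ∞) f) : DifferentiableAt ℝ f p :=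
    hf.differentiable (by simp) p
  have hric : ricci Γ Z W = fun q => ∑ k, ∑ l, ricciCoeff Γ q k l * Z q k * W q l :=
    funext (ricci_apply hΓ hZ hW)
  rw [covRic, ricci_apply hΓ (hX.conn hΓ hZ) hW, ricci_apply hΓ hZ (hX.conn hΓ hW), hric,
    fderiv_bilin (fun k l => diff (contDiff_ricciCoeff hΓ k l)) (fun k => diff (hZ k))
      (fun l => diff (hW l))]
  simp only [conn_apply, mul_add, add_mul, Finset.sum_add_distrib, covRicAt]
  ring

lemma cyclicParallelRic_iff {Γ : Chr ι} (hΓ : SmoothChr Γ) :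
    CyclicParallelRic Γ ↔ ∀ p v, covRicAt Γ p v v v = 0 := by
  refine ⟨fun h p v => ?_, fun h X hX p => ?_⟩
  · rw [← h _ (smoothVF_cvf v) p, covRic_apply hΓ (smoothVF_cvf v) (smoothVF_cvf v)
      (smoothVF_cvf v)]
    rfl
  · rw [covRic_apply hΓ hX hX hX, h]

/-- Contraction commutes with covariant differentiation. -/
lemma trace_szaboMat {Γ : Chr ι} (hΓ : SmoothChr Γ) (p v : Pt ι) :
    (szaboMat Γ p v).trace = covRicAt Γ p v v v := by
  have hv := smoothVF_cvf v
  have diff {f : Pt ι → ℝ} (hf : ContDiff ℝ (⊤ : ℕ∞) f) : DifferentiableAt ℝ f p :=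
    hf.differentiable (by simp) p
  have he (i : ι) := smoothVF_cvf (Pi.single i 1 : Pt ι)
  have hcurv (i : ι) : SmoothVF (curv Γ (cvf (Pi.single i 1)) (cvf v) (cvf v)) := by
    intro m
    simp only [curv_apply hΓ (he i) hv hv]
    exact ContDiff.sum fun j _ => ContDiff.sum fun k _ => ContDiff.sum fun l _ =>
      (((contDiff_curvCoeff hΓ m j k l).mul contDiff_const).mul contDiff_const).mul contDiff_const
  have hexpand (i : ι) : szaboMat Γ p v i i =
      fderiv ℝ (fun q => curv Γ (cvf (Pi.single i 1)) (cvf v) (cvf v) q i) p v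
      + chrApply Γ p v (curv Γ (cvf (Pi.single i 1)) (cvf v) (cvf v) p) i
      - curv Γ (conn Γ (cvf v) (cvf (Pi.single i 1))) (cvf v) (cvf v) p i
      - curv Γ (cvf (Pi.single i 1)) (conn Γ (cvf v) (cvf v)) (cvf v) p i
      - curv Γ (cvf (Pi.single i 1)) (cvf v) (conn Γ (cvf v) (cvf v)) p i := rfl
  have hderiv : ∑ i, fderiv ℝ (fun q => curv Γ (cvf (Pi.single i 1)) (cvf v) (cvf v) q i) p v =
      fderiv ℝ (ricci Γ (cvf v) (cvf v)) p v := by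
    change _ = fderiv ℝ (fun q => ∑ i, curv Γ (cvf (Pi.single i 1)) (cvf v) (cvf v) q i) p v
    rw [fderiv_fun_sum fun i _ => diff (hcurv i i), sum_apply]
  have hcancel : ∑ i, chrApply Γ p v (curv Γ (cvf (Pi.single i 1)) (cvf v) (cvf v) p) i =
      ∑ i, curv Γ (conn Γ (cvf v) (cvf (Pi.single i 1))) (cvf v) (cvf v) p i := by
    have hleft (i m : ι) : curv Γ (cvf (Pi.single i 1)) (cvf v) (cvf v) p m =
        ∑ k, ∑ l, curvCoeff Γ p m i k l * v k * v l := by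
      rw [curv_apply hΓ (he i) hv hv, Finset.sum_eq_single i]
      · simp [cvf]
      · intro j _ hj
        simp [cvf, hj]
      · simp
    have hright (i : ι) : curv Γ (conn Γ (cvf v) (cvf (Pi.single i 1))) (cvf v) (cvf v) p i =
        ∑ m, (∑ j, Γ p m j i * v j) * ∑ k, ∑ l, curvCoeff Γ p i m k l * v k * v l := by
      rw [curv_apply hΓ (hv.conn hΓ (he i)) hv hv]
      refine Finset.sum_congr rfl fun m _ => ?_
      have : conn Γ (cvf v) (cvf (Pi.single i 1)) p m = ∑ j, Γ p m j i * v j := by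
        simp [conn, cvf, Pi.single_apply]
      rw [this, Finset.mul_sum]
      refine Finset.sum_congr rfl fun k _ => ?_
      rw [Finset.mul_sum]
      exact Finset.sum_congr rfl fun l _ => by simp only [cvf]; ring
    simp only [hright, chrApply, hleft]
    rw [Finset.sum_comm (f := fun i m => (∑ j, Γ p m j i * v j) * _)]
    refine Finset.sum_congr rfl fun i _ => ?_
    rw [Finset.sum_comm]
    exact Finset.sum_congr rfl fun m _ => by rw [Finset.sum_mul]
  rw [← show covRic Γ (cvf v) (cvf v) (cvf v) p = covRicAt Γ p v v v from
    covRic_apply hΓ hv hv hv p, Matrix.trace]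
  simp only [Matrix.diag_apply, hexpand, Finset.sum_sub_distrib, Finset.sum_add_distrib, hderiv,
    hcancel]
  simp only [covRic, ricci, cvf]
  ring

lemma smoothChr_gammaA {f1 f2 f3 : Pt (Fin 3) → ℝ} (h1 : ContDiff ℝ (⊤ : ℕ∞) f1)
    (h2 : ContDiff ℝ (⊤ : ℕ∞) f2) (h3 : ContDiff ℝ (⊤ : ℕ∞) f3) :
    SmoothChr (gammaA f1 f2 f3) := by
  intro i j k
  simp only [gammaA]
  split_ifs <;> first | assumption | exact contDiff_const

/-- If `Γ^i_{jk}` vanishes identically for some `i`, then so does the `i`-th row of the affine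
Szabó operators. -/
lemma szaboMat_apply_eq_zero {Γ : Chr ι} (hΓ : SmoothChr Γ) {i : ι} (hi : ∀ p j k, Γ p i j k = 0)
    (p v : Pt ι) (m : ι) : szaboMat Γ p v i m = 0 := by
  have hcurv {X Y Z : VF ι} (hX : SmoothVF X) (hY : SmoothVF Y) (hZ : SmoothVF Z) (q : Pt ι) :
      curv Γ X Y Z q i = 0 := by
    simp [curv_apply hΓ hX hY hZ, curvCoeff, pd, hi]
  have hv := smoothVF_cvf v
  have he := smoothVF_cvf (Pi.single m 1 : Pt ι)
  change conn Γ _ _ p i - curv Γ _ _ _ p i - curv Γ _ _ _ p i - curv Γ _ _ _ p i = 0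
  rw [hcurv (hv.conn hΓ he) hv hv, hcurv he (hv.conn hΓ hv) hv, hcurv he hv (hv.conn hΓ hv),
    conn_apply]
  simp [hcurv he hv hv, chrApply, hi]

lemma charpoly_eq_X_pow_three_iff {A : Matrix (Fin 3) (Fin 3) ℝ}
    (hA : ∀ i, i ≠ 0 → ∀ m, A i m = 0) : A.charpoly = Polynomial.X ^ 3 ↔ A.trace = 0 := by
  have hchar : A.charpoly = Polynomial.X ^ 3 - Polynomial.C (A 0 0) * Polynomial.X ^ 2 := by
    simp [Matrix.charpoly, Matrix.det_fin_three, hA 1 (by decide),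
      hA 2 (by decide)]
    ring
  have htrace : A.trace = A 0 0 := by
    simp [Matrix.trace_fin_three, hA 1 (by decide), hA 2 (by decide)]
  simp [hchar, htrace]

/-- For the Case 1 connection, `(ℝ³,∇)` is affine Szabó (every Szabó operator has
characteristic polynomial `λ³`) iff the Ricci tensor is cyclic parallel. -/
theorem gammaA_szabo_iff_cyclicParallel (f1 f2 f3 : Pt (Fin 3) → ℝ)
    (h1 : ContDiff ℝ (⊤ : ℕ∞) f1) (h2 : ContDiff ℝ (⊤ : ℕ∞) f2) (h3 : ContDiff ℝ (⊤ : ℕ∞) f3) :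
    (∀ p v : Pt (Fin 3), (szaboMat (gammaA f1 f2 f3) p v).charpoly = Polynomial.X ^ 3) ↔
      CyclicParallelRic (gammaA f1 f2 f3) := by
  have hΓ := smoothChr_gammaA h1 h2 h3
  rw [cyclicParallelRic_iff hΓ]
  refine forall_congr' fun p => forall_congr' fun v => ?_
  rw [← trace_szaboMat hΓ]
  exact charpoly_eq_X_pow_three_iff fun i hi =>
    szaboMat_apply_eq_zero hΓ (fun q j k => by simp [gammaA, hi]) p v

end AffineSzabo
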